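/- Fix d ≥ 1 and a real ε with 0 < ε < 1/2. Each Klee-Minty vertex lies within distance ε of the corresponding hypercube vertex: for every bit string b ∈ {0,1}^d and every coordinate i, |v(b)_i − b_i| ≤ ε, where the bit b_i is regarded as the real number 0 or 1. -/

import Mathlib

/-- Helper for the Klee-Minty vertex: value of the top coordinate for a list of bits,
via the downward recursion `v_i = ε·v_{i+1}` if `b_i = 0`, `v_i = 1 - ε·v_{i+1}` if `b_i = 1`,
with `v` of the empty list equal to `0` (so a single bit gives `0` or `1`). -/
noncomputable def kmF (ε : ℝ) : List Bool → ℝ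
  | [] => 0
  | x :: l => if x = true then 1 - ε * kmF ε l else ε * kmF ε l

/-- The Klee-Minty vertex `v(b) ∈ ℝ^d` of a bit string `b ∈ {0,1}^d`:
`v(b)_{d-1} = b_{d-1}` and `v(b)_i = ε·v(b)_{i+1}` if `b_i = 0`,
`v(b)_i = 1 - ε·v(b)_{i+1}` if `b_i = 1` (0-indexed). -/
noncomputable def kmVertex (ε : ℝ) (d : ℕ) (b : Fin d → Bool) : Fin d → ℝ :=
  fun i => kmF ε ((List.ofFn b).drop i.val)

theorem kmF_mem_Icc {ε : ℝ} (h0 : 0 ≤ ε) (h1 : ε ≤ 1) (l : List Bool) :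
    kmF ε l ∈ Set.Icc (0 : ℝ) 1 := by
  induction l with
  | nil => simp [kmF]
  | cons x l ih =>
    obtain ⟨hl, hu⟩ := ih
    have hm0 : 0 ≤ ε * kmF ε l := mul_nonneg h0 hl
    have hm1 : ε * kmF ε l ≤ 1 := mul_le_one₀ h1 hl hu
    cases x <;> simp [kmF, hm0, hm1]

theorem abs_kmF_cons_sub_le {ε : ℝ} (h0 : 0 ≤ ε) (h1 : ε ≤ 1) (x : Bool) (l : List Bool) :
    |kmF ε (x :: l) - (if x = true then (1 : ℝ) else 0)| ≤ ε := by
  obtain ⟨hl, hu⟩ := kmF_mem_Icc h0 h1 l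
  have hm0 : 0 ≤ ε * kmF ε l := mul_nonneg h0 hl
  have hm1 : ε * kmF ε l ≤ ε := mul_le_of_le_one_right h0 hu
  rw [abs_le]
  cases x <;> simp only [kmF, if_true, Bool.false_eq_true, if_false] <;>
    constructor <;> linarith

/-- Each Klee-Minty vertex lies within distance `ε` of the corresponding hypercube
vertex in every coordinate. -/
theorem kmVertex_close_to_cube (d : ℕ) (hd : 1 ≤ d) (ε : ℝ)
    (hε0 : 0 < ε) (hε1 : ε < 1 / 2) (b : Fin d → Bool) (i : Fin d) :
    |kmVertex ε d b i - (if b i = true then (1 : ℝ) else 0)| ≤ ε := by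
  have hi : i.val < (List.ofFn b).length := by simp
  have h := abs_kmF_cons_sub_le hε0.le (by linarith) (b i) ((List.ofFn b).drop (i.val + 1))
  rw [kmVertex, List.drop_eq_getElem_cons hi, List.getElem_ofFn]
  exact h
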